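/- arXiv:1401.3261 — 6 statements merged into one kernel-verified Lean document; each statement's English description precedes it below -/
import Mathlib

section
/- Fix d ≥ 1, ε > 0 and transaction-cost coefficients λ^{i,j} ∈ [0,+∞] (0 ≤ i,j ≤ d) with λ^{i,i} = 0 and λ^{i,0} < +∞, λ^{0,i} < +∞ for every i = 1,…,d. Then for every (x,y) ∈ ℝ × ℝ^d one has 0 ≤ x + Σ_{i=1}^d y^i − ℓ^ε(x,y) ≤ ε³ Σ_{i=1}^d [ (y^i)^+ λ^{i,0}/(1+ε³λ^{i,0}) + (y^i)^- λ^{0,i} ]. In particular (x + Σ_{i=1}^d y^i − ℓ^ε(x,y))/ε³ is nonnegative and bounded uniformly on compact subsets of ℝ × ℝ^d and uniformly in ε ∈ (0,1], so that 0 ≤ limsup_{ε↓0} (x + Σ_i y^i − ℓ^ε(x,y))/ε³ < +∞ uniformly on compact sets. -/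
theorem liq_term_bound (e L M y r : ℝ) (he : 0 < e) (hL : 0 ≤ L)
    (h1 : 1 ≤ (1 + e * L) * r) (h2 : r ≤ 1 + e * M) :
    y - e * (max y 0 * L / (1 + e * L) + max (-y) 0 * M) ≤ y * r := by
  have hp : 0 < 1 + e * L := by positivity
  rcases le_total 0 y with hy | hy
  · rw [max_eq_left hy, max_eq_right (by linarith)]
    have h3 : 1 / (1 + e * L) ≤ r := by
      rw [div_le_iff₀ hp]; linarith
    have h4 : y - e * (y * L / (1 + e * L) + 0 * M) = y * (1 / (1 + e * L)) := by
      field_simp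
      ring
    rw [h4]
    exact mul_le_mul_of_nonneg_left h3 hy
  · rw [max_eq_right hy, max_eq_left (by linarith)]
    have h3 := mul_le_mul_of_nonpos_left h2 hy
    have h4 : y - e * (0 * L / (1 + e * L) + -y * M) = y * (1 + e * M) := by
      simp
      ring
    rw [h4]
    exact h3



open scoped ENNReal BigOperators

/-- The dual cone `K_ε^*` of the solvency region, for transaction costs
`ε³ λ^{i,j}` with `λ : Fin (d+1) → Fin (d+1) → ℝ≥0∞`. -/
noncomputable def dualCone (d : ℕ) (ε : ℝ) (lam : Fin (d + 1) → Fin (d + 1) → ℝ≥0∞) :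
    Set (Fin (d + 1) → ℝ) :=
  {r | (∀ i, 0 ≤ r i) ∧ r 0 = 1 ∧
    ∀ i j, lam i j ≠ ∞ → r j ≤ (1 + ε ^ 3 * (lam i j).toReal) * r i}

/-- The liquidation function `ℓ^ε(x,y) := inf_{r ∈ K_ε^*} (x r⁰ + Σ_i yⁱ rⁱ)`. -/
noncomputable def liq (d : ℕ) (ε : ℝ) (lam : Fin (d + 1) → Fin (d + 1) → ℝ≥0∞)
    (x : ℝ) (y : Fin d → ℝ) : ℝ :=
  sInf ((fun r : Fin (d + 1) → ℝ => x * r 0 + ∑ i : Fin d, y i * r i.succ) ''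
    dualCone d ε lam)

theorem stmt0 (d : ℕ) (hd : 1 ≤ d) (ε : ℝ) (hε : 0 < ε)
    (lam : Fin (d + 1) → Fin (d + 1) → ℝ≥0∞)
    (hdiag : ∀ i, lam i i = 0)
    (hrow : ∀ i : Fin d, lam i.succ 0 ≠ ∞)
    (hcol : ∀ i : Fin d, lam 0 i.succ ≠ ∞)
    (x : ℝ) (y : Fin d → ℝ) :
    0 ≤ x + ∑ i, y i - liq d ε lam x y ∧
      x + ∑ i, y i - liq d ε lam x y ≤
        ε ^ 3 * ∑ i : Fin d,
          (max (y i) 0 * (lam i.succ 0).toReal / (1 + ε ^ 3 * (lam i.succ 0).toReal)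
            + max (-y i) 0 * (lam 0 i.succ).toReal) := by
  have he : 0 < ε ^ 3 := by positivity
  have hone : (fun _ => 1 : Fin (d + 1) → ℝ) ∈ dualCone d ε lam := by
    refine ⟨fun _ => zero_le_one, rfl, fun i j _ => ?_⟩
    have : 0 ≤ ε ^ 3 * (lam i j).toReal := mul_nonneg he.le ENNReal.toReal_nonneg
    simpa using this
  have hlb : ∀ v ∈ (fun r : Fin (d + 1) → ℝ => x * r 0 + ∑ i : Fin d, y i * r i.succ) ''
      dualCone d ε lam, x + ∑ i, y i - ε ^ 3 * ∑ i : Fin d,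
          (max (y i) 0 * (lam i.succ 0).toReal / (1 + ε ^ 3 * (lam i.succ 0).toReal)
            + max (-y i) 0 * (lam 0 i.succ).toReal) ≤ v := by
    rintro _ ⟨r, ⟨_, hr0, hr⟩, rfl⟩
    have hs : ∑ i : Fin d, (y i - ε ^ 3 *
          (max (y i) 0 * (lam i.succ 0).toReal / (1 + ε ^ 3 * (lam i.succ 0).toReal)
            + max (-y i) 0 * (lam 0 i.succ).toReal)) ≤ ∑ i : Fin d, y i * r i.succ := by
      refine Finset.sum_le_sum fun i _ => ?_
      have h1 := hr _ _ (hrow i)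
      have h2 := hr _ _ (hcol i)
      rw [hr0] at h1 h2
      rw [mul_one] at h2
      exact liq_term_bound _ _ _ _ _ he ENNReal.toReal_nonneg h1 h2
    rw [Finset.sum_sub_distrib, ← Finset.mul_sum] at hs
    simp only [hr0, mul_one]
    linarith
  constructor
  · have h : liq d ε lam x y ≤ x + ∑ i, y i :=
      csInf_le ⟨_, hlb⟩ ⟨_, hone, by simp⟩
    linarith
  · have h := le_csInf ((Set.nonempty_of_mem hone).image _) hlb
    change _ ≤ liq d ε lam x y at h
    linarith
end

section
/- Let κ ∈ {0,1} and suppose v₂ : [0,T] → ℝ is differentiable with v₂(T) = 0 and v₂'(t) = κ v₁(t)(log v₁(t) + v₂(t) − 1) + θ/2 for t ∈ [0,T). Define v(t,s,z) := −exp(−γ v₁(t)(z − V(t,s)) + v₂(t)). Then v is C^{1,2,2} on [0,T)×(0,∞)^d×(0,∞), satisfies the terminal condition v(T,s,z) = −e^{−γ(z−g(s))}, has v_z(t,s,z) > 0 and v_{zz}(t,s,z) < 0, and solves the frictionless Merton HJB equation: for all (t,s,z) ∈ [0,T)×(0,∞)^d×(0,∞), −v_t − μ·D_s v − (1/2)Tr[σσᵀ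 D_{ss} v] − r z v_z − κ Ũ₁(v_z) − sup_{y ∈ ℝ^d} { y·((μ − r·1_d) v_z + σσᵀ D_{sz} v) + (1/2)|σᵀ y|² v_{zz} } = 0, where Ũ₁(c̃) := (c̃/γ)(log(c̃/γ) − 1) for c̃ > 0. Moreover, for each (t,s,z) the supremum over y is attained at the unique point y^g(t,s) := D_s V(t,s) + (1/(γ v₁(t))) (σσᵀ)^{-1}(μ − r·1_d). -/
open scoped BigOperators

/-- Partial derivative of `φ : (Fin d → ℝ) → ℝ` in the `i`-th coordinate at `s`. -/
noncomputable def pd {d : ℕ} (φ : (Fin d → ℝ) → ℝ) (i : Fin d) (s : Fin d → ℝ) : ℝ :=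
  deriv (fun a => φ (Function.update s i a)) (s i)

/-- The time factor `v₁(t) = r / (κ + e^{-r(T-t)}(r-κ))` of the explicit Merton
value function for exponential utility. -/
noncomputable def v1 (r T κ t : ℝ) : ℝ := r / (κ + Real.exp (-(r * (T - t))) * (r - κ))

/-- The convex conjugate `Ũ₁(c̃) = (c̃/γ)(log(c̃/γ) - 1)` of the exponential utility
`U₁(c) = -e^{-γc}`. -/
noncomputable def Utilde1 (γ c : ℝ) : ℝ := c / γ * (Real.log (c / γ) - 1)

section helpers
open Matrix

lemma v1_den_pos (r T κ t : ℝ) (hr : 0 < r) (hκ : κ = 0 ∨ κ = 1) (ht : t ≤ T) :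
    0 < κ + Real.exp (-(r * (T - t))) * (r - κ) := by
  have h0 := Real.exp_pos (-(r * (T - t)))
  have h1 : Real.exp (-(r * (T - t))) ≤ 1 := by
    rw [Real.exp_le_one_iff]
    nlinarith
  rcases hκ with rfl | rfl <;> nlinarith

lemma v1_pos (r T κ t : ℝ) (hr : 0 < r) (hκ : κ = 0 ∨ κ = 1) (ht : t ≤ T) :
    0 < v1 r T κ t := div_pos hr (v1_den_pos r T κ t hr hκ ht)

lemma v1_T (r T κ : ℝ) (hr : 0 < r) : v1 r T κ T = 1 := by
  unfold v1
  simp [hr.ne']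

lemma v1_deriv (r T κ t : ℝ) (hr : 0 < r) (hκ : κ = 0 ∨ κ = 1) (ht : t ≤ T) :
    HasDerivAt (v1 r T κ) (-(r * v1 r T κ t) + κ * v1 r T κ t ^ 2) t := by
  have hD := (v1_den_pos r T κ t hr hκ ht).ne'
  have h1 : HasDerivAt (fun u : ℝ => -(r * (T - u))) r t := by
    have := (((hasDerivAt_id t).const_sub T).const_mul r).neg
    refine HasDerivAt.congr_deriv this ?_
    ring
  have h2 := ((h1.exp.mul_const (r - κ)).const_add κ)
  have h3 := (hasDerivAt_const t r).div h2 hD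
  refine HasDerivAt.congr_deriv h3 ?_
  unfold v1
  field_simp
  ring

lemma quad_eq {d : ℕ} (σ : Matrix (Fin d) (Fin d) ℝ) (y : Fin d → ℝ) :
    ∑ i, (∑ j, σ j i * y j) ^ 2 = y ⬝ᵥ (σ * σᵀ) *ᵥ y := by
  rw [← Matrix.mulVec_mulVec, Matrix.dotProduct_mulVec, ← Matrix.mulVec_transpose]
  simp [dotProduct, Matrix.mulVec, sq]

lemma quad_symm {d : ℕ} (σ : Matrix (Fin d) (Fin d) ℝ) (x y : Fin d → ℝ) :
    y ⬝ᵥ (σ * σᵀ) *ᵥ x = x ⬝ᵥ (σ * σᵀ) *ᵥ y := by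
  rw [Matrix.dotProduct_mulVec, ← Matrix.mulVec_transpose, dotProduct_comm]
  simp [Matrix.transpose_mul]

lemma quad_opt {d : ℕ} (σ : Matrix (Fin d) (Fin d) ℝ) (c : ℝ) (y ys : Fin d → ℝ) :
    y ⬝ᵥ (c • (σ * σᵀ) *ᵥ ys) + 1 / 2 * (∑ i, (∑ j, σ j i * y j) ^ 2) * (-c)
      = 1 / 2 * c * (ys ⬝ᵥ (σ * σᵀ) *ᵥ ys)
        - 1 / 2 * c * ∑ i, (∑ j, σ j i * (y - ys) j) ^ 2 := by
  rw [quad_eq, quad_eq, Matrix.mulVec_sub, dotProduct_sub, sub_dotProduct, sub_dotProduct,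
    dotProduct_smul, quad_symm σ y ys, smul_eq_mul]
  ring

lemma quad_zero {d : ℕ} (σ : Matrix (Fin d) (Fin d) ℝ) (hσ : IsUnit σ.det) (y : Fin d → ℝ)
    (h : ∑ i, (∑ j, σ j i * y j) ^ 2 = 0) : y = 0 := by
  rw [Finset.sum_eq_zero_iff_of_nonneg (fun i _ => sq_nonneg _)] at h
  have h1 : σᵀ *ᵥ y = 0 := by
    funext i
    have := h i (Finset.mem_univ i)
    simpa [Matrix.mulVec, dotProduct] using this
  have hdet : IsUnit (σᵀ).det := by simpa using hσ
  have := congrArg ((σᵀ)⁻¹ *ᵥ ·) h1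
  simpa [Matrix.mulVec_mulVec, Matrix.nonsing_inv_mul _ hdet] using this

lemma isOpen_pos (d : ℕ) : IsOpen {s : Fin d → ℝ | ∀ i, 0 < s i} := by
  simp only [Set.ofPred_forall]
  exact isOpen_iInter_of_finite fun i => isOpen_lt continuous_const (continuous_apply i)

lemma line_deriv {d : ℕ} {φ : (Fin d → ℝ) → ℝ} {s : Fin d → ℝ} (i : Fin d)
    (h : DifferentiableAt ℝ φ s) :
    HasDerivAt (fun a => φ (Function.update s i a)) (fderiv ℝ φ s (Pi.single i 1)) (s i) := by
  have h1 := hasDerivAt_update s i (s i)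
  have h2 : HasFDerivAt φ (fderiv ℝ φ s) (Function.update s i (s i)) := by
    simpa using h.hasFDerivAt
  exact h2.comp_hasDerivAt (s i) h1

lemma pd_eq {d : ℕ} {φ : (Fin d → ℝ) → ℝ} {s : Fin d → ℝ} (i : Fin d)
    (h : DifferentiableAt ℝ φ s) : pd φ i s = fderiv ℝ φ s (Pi.single i 1) :=
  (line_deriv i h).deriv

lemma pd_hasDeriv {d : ℕ} {φ : (Fin d → ℝ) → ℝ} {s : Fin d → ℝ} (i : Fin d)
    (h : DifferentiableAt ℝ φ s) :
    HasDerivAt (fun a => φ (Function.update s i a)) (pd φ i s) (s i) := by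
  rw [pd_eq i h]; exact line_deriv i h

lemma pd_diff {d : ℕ} {φ : (Fin d → ℝ) → ℝ} (h : ContDiffOn ℝ 2 φ {s | ∀ i, 0 < s i})
    {s : Fin d → ℝ} (hs : ∀ i, 0 < s i) (j : Fin d) : DifferentiableAt ℝ (pd φ j) s := by
  have hmem := (isOpen_pos d).mem_nhds hs
  have hc := h.contDiffAt hmem
  have h1 : DifferentiableAt ℝ (fderiv ℝ φ) s :=
    (hc.fderiv_right (m := 1) (by norm_num)).differentiableAt (by norm_num)
  have h2 : DifferentiableAt ℝ (fun x => fderiv ℝ φ x (Pi.single j 1)) s :=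
    h1.clm_apply (differentiableAt_const _)
  refine h2.congr_of_eventuallyEq ?_
  filter_upwards [hmem] with x hx
  exact pd_eq j ((h.contDiffAt ((isOpen_pos d).mem_nhds hx)).differentiableAt (by norm_num))

/-- First spatial derivative of a constant times `exp (a + b φ)`. -/
lemma pd_exp {d : ℕ} {φ : (Fin d → ℝ) → ℝ} {s : Fin d → ℝ} (i : Fin d)
    (h : DifferentiableAt ℝ φ s) (k a b : ℝ) :
    pd (fun s' => k * Real.exp (a + b * φ s')) i s
      = k * Real.exp (a + b * φ s) * (b * pd φ i s) := by
  have h1 := ((((pd_hasDeriv i h).const_mul b).const_add a).exp).const_mul k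
  have h2 := h1.deriv
  simp only [Function.update_eq_self] at h2
  unfold pd at h2 ⊢
  rw [h2]; ring

lemma pd_pd_exp {d : ℕ} {φ : (Fin d → ℝ) → ℝ} (hφ : ContDiffOn ℝ 2 φ {s | ∀ i, 0 < s i})
    {s : Fin d → ℝ} (hs : ∀ i, 0 < s i) (i j : Fin d) (k a b : ℝ) :
    pd (pd (fun s' => k * Real.exp (a + b * φ s')) j) i s
      = k * Real.exp (a + b * φ s) * (b ^ 2 * (pd φ i s * pd φ j s) + b * pd (pd φ j) i s) := by
  have hd : ∀ x : Fin d → ℝ, (∀ i, 0 < x i) → DifferentiableAt ℝ φ x := fun x hx =>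
    (hφ.contDiffAt ((isOpen_pos d).mem_nhds hx)).differentiableAt (by norm_num)
  have hev : (fun u => pd (fun s' => k * Real.exp (a + b * φ s')) j (Function.update s i u))
      =ᶠ[nhds (s i)] fun u => k * Real.exp (a + b * φ (Function.update s i u))
        * (b * pd φ j (Function.update s i u)) := by
    have hc : Filter.Tendsto (fun u => Function.update s i u) (nhds (s i)) (nhds s) := by
      have := (hasDerivAt_update s i (s i)).continuousAt.tendsto
      simpa using this
    filter_upwards [hc.eventually ((isOpen_pos d).mem_nhds hs)] with u hu
    exact pd_exp j (hd _ hu) k a b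
  have h1 := ((((pd_hasDeriv i (hd s hs)).const_mul b).const_add a).exp).const_mul k
  have h2 := (pd_hasDeriv i (pd_diff hφ hs j)).const_mul b
  have h3 := (h1.mul h2).deriv
  simp only [Function.update_eq_self] at h3
  rw [show pd (pd (fun s' => k * Real.exp (a + b * φ s')) j) i s = _ from hev.deriv_eq]
  refine Eq.trans h3 ?_
  ring

end helpers

theorem stmt2 (d : ℕ) (hd : 1 ≤ d) (T r γ κ : ℝ) (hT : 0 < T) (hr : 0 < r)
    (hγ : 0 < γ) (hκ : κ = 0 ∨ κ = 1)
    (μ : Fin d → ℝ) (σ : Matrix (Fin d) (Fin d) ℝ) (hσ : IsUnit σ.det)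
    (θ : ℝ)
    (hθ : θ = ∑ i, (μ i - r) * (σ * σ.transpose)⁻¹.mulVec (fun j => μ j - r) i)
    (g : (Fin d → ℝ) → ℝ)
    (V : ℝ → (Fin d → ℝ) → ℝ)
    -- V is C^{1,2} on [0,T) × (0,∞)^d, continuous up to time T,
    (hVt : ∀ t ∈ Set.Ico (0 : ℝ) T, ∀ s : Fin d → ℝ, (∀ i, 0 < s i) →
      DifferentiableAt ℝ (fun u => V u s) t)
    (hVs : ∀ t ∈ Set.Ico (0 : ℝ) T, ContDiffOn ℝ 2 (V t) {s | ∀ i, 0 < s i})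
    (hVcont : ContinuousOn (fun q : ℝ × (Fin d → ℝ) => V q.1 q.2)
      (Set.Icc 0 T ×ˢ {s | ∀ i, 0 < s i}))
    -- and solves the Black–Scholes PDE with terminal condition g:
    (hVpde : ∀ t ∈ Set.Ico (0 : ℝ) T, ∀ s : Fin d → ℝ, (∀ i, 0 < s i) →
      -(deriv (fun u => V u s) t) - ∑ i, r * (s i * pd (V t) i s)
        - 1 / 2 * ∑ i, ∑ j, (σ * σ.transpose) i j * (s i * s j * pd (pd (V t) j) i s)
        + r * V t s = 0)
    (hVterm : ∀ s : Fin d → ℝ, (∀ i, 0 < s i) → V T s = g s)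
    -- v₂ solves the ODE with terminal condition 0:
    (v₂ : ℝ → ℝ) (hv₂T : v₂ T = 0)
    (hv₂' : ∀ t ∈ Set.Ico (0 : ℝ) T,
      HasDerivAt v₂ (κ * v1 r T κ t * (Real.log (v1 r T κ t) + v₂ t - 1) + θ / 2) t)
    -- the candidate value function:
    (v : ℝ → (Fin d → ℝ) → ℝ → ℝ)
    (hv : ∀ t s z, v t s z = -Real.exp (-(γ * v1 r T κ t * (z - V t s)) + v₂ t))
    -- the candidate optimal portfolio y^g(t,s) = D_s V + (1/(γv₁))(σσᵀ)⁻¹(μ - r1):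
    (yg : ℝ → (Fin d → ℝ) → Fin d → ℝ)
    (hyg : ∀ t s i, yg t s i = s i * pd (V t) i s
      + 1 / (γ * v1 r T κ t) * (σ * σ.transpose)⁻¹.mulVec (fun j => μ j - r) i)
    -- the function inside the supremum of the HJB equation:
    (F : ℝ → (Fin d → ℝ) → ℝ → (Fin d → ℝ) → ℝ)
    (hF : ∀ t s z y, F t s z y =
      (∑ i, y i * ((μ i - r) * deriv (fun z' => v t s z') z
        + ∑ j, (σ * σ.transpose) i j
            * (s j * pd (fun s' => deriv (fun z' => v t s' z') z) j s)))
      + 1 / 2 * (∑ i, (∑ j, σ j i * y j) ^ 2) * deriv (deriv fun z' => v t s z') z) :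
    -- (a) v is C^{1,2,2} on [0,T) × (0,∞)^d × (0,∞):
    ((∀ s : Fin d → ℝ, (∀ i, 0 < s i) → ∀ z : ℝ, 0 < z → ∀ t ∈ Set.Ico (0 : ℝ) T,
        DifferentiableAt ℝ (fun u => v u s z) t) ∧
      (∀ t ∈ Set.Ico (0 : ℝ) T, ∀ z : ℝ, 0 < z →
        ContDiffOn ℝ 2 (fun s => v t s z) {s | ∀ i, 0 < s i}) ∧
      (∀ t ∈ Set.Ico (0 : ℝ) T, ∀ s : Fin d → ℝ, (∀ i, 0 < s i) →
        ContDiffOn ℝ 2 (fun z => v t s z) (Set.Ioi 0))) ∧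
    -- (b) terminal condition:
    (∀ s : Fin d → ℝ, (∀ i, 0 < s i) → ∀ z : ℝ,
      v T s z = -Real.exp (-(γ * (z - g s)))) ∧
    -- (c) v_z > 0 and v_{zz} < 0:
    (∀ t ∈ Set.Ico (0 : ℝ) T, ∀ s : Fin d → ℝ, (∀ i, 0 < s i) → ∀ z : ℝ, 0 < z →
      0 < deriv (fun z' => v t s z') z ∧ deriv (deriv fun z' => v t s z') z < 0) ∧
    -- (d) v solves the frictionless Merton HJB equation:
    (∀ t ∈ Set.Ico (0 : ℝ) T, ∀ s : Fin d → ℝ, (∀ i, 0 < s i) → ∀ z : ℝ, 0 < z →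
      -(deriv (fun u => v u s z) t)
        - ∑ i, μ i * (s i * pd (fun s' => v t s' z) i s)
        - 1 / 2 * ∑ i, ∑ j, (σ * σ.transpose) i j
            * (s i * s j * pd (pd (fun s' => v t s' z) j) i s)
        - r * z * deriv (fun z' => v t s z') z
        - κ * Utilde1 γ (deriv (fun z' => v t s z') z)
        - sSup (Set.range (F t s z)) = 0) ∧
    -- (e) the supremum is attained at the unique point y^g(t,s):
    (∀ t ∈ Set.Ico (0 : ℝ) T, ∀ s : Fin d → ℝ, (∀ i, 0 < s i) → ∀ z : ℝ, 0 < z →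
      (∀ y : Fin d → ℝ, F t s z y ≤ F t s z (yg t s)) ∧
      (∀ y : Fin d → ℝ, F t s z y = F t s z (yg t s) → y = yg t s)) := by
  have hvz : ∀ t s z, HasDerivAt (fun z' => v t s z') (-(γ * v1 r T κ t) * v t s z) z := by
    intro t s z
    have h1 : HasDerivAt (fun z' : ℝ => -(γ * v1 r T κ t * (z' - V t s)) + v₂ t)
        (-(γ * v1 r T κ t)) z := by
      simpa using ((((hasDerivAt_id z).sub_const (V t s)).const_mul
        (γ * v1 r T κ t)).neg.add_const (v₂ t))
    have h2 := h1.exp.neg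
    simp only [hv]
    refine h2.congr_deriv ?_
    ring
  have hdz : ∀ t s, (deriv fun z' => v t s z') = fun z => -(γ * v1 r T κ t) * v t s z := by
    intro t s; funext z; exact (hvz t s z).deriv
  have hdzz : ∀ t s z, deriv (deriv fun z' => v t s z') z = (γ * v1 r T κ t) ^ 2 * v t s z := by
    intro t s z
    rw [hdz, ((hvz t s z).const_mul _).deriv]; ring
  have hvneg : ∀ t s z, v t s z < 0 := by
    intro t s z; rw [hv]; exact neg_neg_of_pos (Real.exp_pos _)
  have hvform : ∀ t z, (fun s' => v t s' z) = fun s' =>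
      (-1) * Real.exp ((-(γ * v1 r T κ t * z) + v₂ t) + (γ * v1 r T κ t) * V t s') := by
    intro t z; funext s'; rw [hv]; rw [neg_one_mul]; congr 2; ring
  have hvform' : ∀ t s z, (-1) * Real.exp ((-(γ * v1 r T κ t * z) + v₂ t)
      + (γ * v1 r T κ t) * V t s) = v t s z := fun t s z => (congrFun (hvform t z) s).symm
  have hVd : ∀ t ∈ Set.Ico (0 : ℝ) T, ∀ s : Fin d → ℝ, (∀ i, 0 < s i) →
      DifferentiableAt ℝ (V t) s := fun t ht s hs =>
    ((hVs t ht).contDiffAt ((isOpen_pos d).mem_nhds hs)).differentiableAt (by norm_num)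
  have hpd : ∀ t ∈ Set.Ico (0 : ℝ) T, ∀ s : Fin d → ℝ, (∀ i, 0 < s i) → ∀ z i,
      pd (fun s' => v t s' z) i s = v t s z * ((γ * v1 r T κ t) * pd (V t) i s) := by
    intro t ht s hs z i
    rw [hvform, pd_exp i (hVd t ht s hs), hvform']
  have hpdpd : ∀ t ∈ Set.Ico (0 : ℝ) T, ∀ s : Fin d → ℝ, (∀ i, 0 < s i) → ∀ z i j,
      pd (pd (fun s' => v t s' z) j) i s = v t s z * ((γ * v1 r T κ t) ^ 2
        * (pd (V t) i s * pd (V t) j s) + (γ * v1 r T κ t) * pd (pd (V t) j) i s) := by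
    intro t ht s hs z i j
    rw [hvform, pd_pd_exp (hVs t ht) hs, hvform']
  have hpdz : ∀ t ∈ Set.Ico (0 : ℝ) T, ∀ s : Fin d → ℝ, (∀ i, 0 < s i) → ∀ z i,
      pd (fun s' => deriv (fun z' => v t s' z') z) i s
        = -((γ * v1 r T κ t) ^ 2 * v t s z) * pd (V t) i s := by
    intro t ht s hs z i
    have : (fun s' => deriv (fun z' => v t s' z') z) = fun s' =>
        (γ * v1 r T κ t) * Real.exp ((-(γ * v1 r T κ t * z) + v₂ t)
          + (γ * v1 r T κ t) * V t s') := by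
      funext s'
      rw [(hvz t s' z).deriv, ← hvform']; ring
    rw [this, pd_exp i (hVd t ht s hs), ← hvform']; ring
  have hvt : ∀ t ∈ Set.Ico (0 : ℝ) T, ∀ s : Fin d → ℝ, (∀ i, 0 < s i) → ∀ z,
      HasDerivAt (fun u => v u s z) (v t s z *
        (-(γ * (-(r * v1 r T κ t) + κ * v1 r T κ t ^ 2) * (z - V t s))
          + γ * v1 r T κ t * deriv (fun u => V u s) t
          + (κ * v1 r T κ t * (Real.log (v1 r T κ t) + v₂ t - 1) + θ / 2))) t := by
    intro t ht s hs z
    have h1 := (v1_deriv r T κ t hr hκ ht.2.le).const_mul γ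
    have h2 := (hVt t ht s hs).hasDerivAt.const_sub z
    have h3 := (((h1.mul h2).neg.add (hv₂' t ht)).exp).neg
    have h4 : (fun u => v u s z) = _ := funext fun u => hv u s z
    rw [h4, hv t s z]
    refine h3.congr_deriv ?_
    simp only [Pi.mul_apply, Pi.neg_apply, Pi.add_apply]
    ring
  -- the covariance matrix
  have hM : IsUnit (σ * σ.transpose).det := by
    rw [Matrix.det_mul, Matrix.det_transpose]; exact hσ.mul hσ
  have hMinv : ∀ b : Fin d → ℝ, (σ * σ.transpose).mulVec ((σ * σ.transpose)⁻¹.mulVec b) = b := by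
    intro b
    rw [Matrix.mulVec_mulVec, Matrix.mul_nonsing_inv _ hM, Matrix.one_mulVec]
  have hygv : ∀ t s, yg t s = (fun i => s i * pd (V t) i s) + (1 / (γ * v1 r T κ t)) •
      (σ * σ.transpose)⁻¹.mulVec (fun j => μ j - r) := by
    intro t s; funext i; simp [hyg]
  have hFq : ∀ t ∈ Set.Ico (0 : ℝ) T, ∀ s : Fin d → ℝ, (∀ i, 0 < s i) → ∀ z y,
      F t s z y = 1 / 2 * ((γ * v1 r T κ t) ^ 2 * (-v t s z))
          * (yg t s ⬝ᵥ (σ * σ.transpose).mulVec (yg t s))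
        - 1 / 2 * ((γ * v1 r T κ t) ^ 2 * (-v t s z))
          * ∑ i, (∑ j, σ j i * (y - yg t s) j) ^ 2 := by
    intro t ht s hs z y
    have hp : γ * v1 r T κ t ≠ 0 := (mul_pos hγ (v1_pos r T κ t hr hκ ht.2.le)).ne'
    rw [← quad_opt, hF, hdzz]
    congr 1
    · rw [dotProduct]
      refine Finset.sum_congr rfl fun i _ => ?_
      congr 1
      rw [hygv, Matrix.mulVec_add, Matrix.mulVec_smul, hMinv, (hvz t s z).deriv]
      simp only [hpdz t ht s hs, Pi.smul_apply, Pi.add_apply, smul_eq_mul, Matrix.mulVec, dotProduct]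
      rw [mul_add, Finset.mul_sum, add_comm]
      congr 1
      · refine Finset.sum_congr rfl fun j _ => ?_
        ring
      · field_simp
    · ring
  have hc : ∀ t ∈ Set.Ico (0 : ℝ) T, ∀ s z, 0 < (γ * v1 r T κ t) ^ 2 * (-v t s z) := by
    intro t ht s z
    have := mul_pos hγ (v1_pos r T κ t hr hκ ht.2.le)
    have := hvneg t s z
    exact mul_pos (by positivity) (by linarith)
  have hFyg : ∀ t ∈ Set.Ico (0 : ℝ) T, ∀ s : Fin d → ℝ, (∀ i, 0 < s i) → ∀ z,
      F t s z (yg t s) = 1 / 2 * ((γ * v1 r T κ t) ^ 2 * (-v t s z))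
          * (yg t s ⬝ᵥ (σ * σ.transpose).mulVec (yg t s)) := by
    intro t ht s hs z
    rw [hFq t ht s hs]; simp
  have hle : ∀ t ∈ Set.Ico (0 : ℝ) T, ∀ s : Fin d → ℝ, (∀ i, 0 < s i) → ∀ z y,
      F t s z y ≤ F t s z (yg t s) := by
    intro t ht s hs z y
    rw [hFyg t ht s hs, hFq t ht s hs]
    have h1 := hc t ht s z
    have h2 : 0 ≤ ∑ i, (∑ j, σ j i * (y - yg t s) j) ^ 2 :=
      Finset.sum_nonneg fun i _ => sq_nonneg _
    have := mul_nonneg (mul_nonneg (by norm_num : (0 : ℝ) ≤ 1 / 2) h1.le) h2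
    linarith
  refine ⟨⟨?_, ?_, ?_⟩, ?_, ?_, ?_, ?_⟩
  · intro s hs z _ t ht
    exact (hvt t ht s hs z).differentiableAt
  · intro t ht z _
    rw [hvform]
    exact contDiffOn_const.mul ((contDiffOn_const.add (contDiffOn_const.mul (hVs t ht))).exp)
  · intro t ht s hs
    simp only [hv]
    fun_prop
  · intro s hs z
    rw [hv, v1_T r T κ hr, hv₂T, hVterm s hs]; simp
  · intro t ht s hs z _
    have h0 := hvneg t s z
    have hp := mul_pos hγ (v1_pos r T κ t hr hκ ht.2.le)
    have h1 := hc t ht s z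
    rw [hdzz, (hvz t s z).deriv]
    constructor <;> nlinarith
  · intro t ht s hs z _
    have hp1 := v1_pos r T κ t hr hκ ht.2.le
    have hsup : sSup (Set.range (F t s z)) = F t s z (yg t s) := by
      apply IsGreatest.csSup_eq
      refine ⟨⟨_, rfl⟩, ?_⟩
      rintro _ ⟨y, rfl⟩
      exact hle t ht s hs z y
    have hpde := hVpde t ht s hs
    rw [hsup, hFyg t ht s hs, (hvz t s z).deriv, (hvt t ht s hs z).deriv]
    simp only [hpd t ht s hs, hpdpd t ht s hs]
    have hlog : Real.log (-(γ * v1 r T κ t) * v t s z / γ)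
        = Real.log (v1 r T κ t) + (-(γ * v1 r T κ t * (z - V t s)) + v₂ t) := by
      rw [hv, show -(γ * v1 r T κ t) * -Real.exp (-(γ * v1 r T κ t * (z - V t s)) + v₂ t) / γ
        = v1 r T κ t * Real.exp (-(γ * v1 r T κ t * (z - V t s)) + v₂ t) by field_simp,
        Real.log_mul hp1.ne' (Real.exp_pos _).ne', Real.log_exp]
    have hdiv : -(γ * v1 r T κ t) * v t s z / γ = -(v1 r T κ t * v t s z) := by field_simp
    rw [Utilde1, hlog, hdiv]
    -- expand the quadratic form at the optimum
    have hquad : (γ * v1 r T κ t) ^ 2 * (yg t s ⬝ᵥ (σ * σ.transpose).mulVec (yg t s))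
        = (γ * v1 r T κ t) ^ 2 * (∑ i, ∑ j, (σ * σ.transpose) i j
            * (s i * s j * (pd (V t) i s * pd (V t) j s)))
          + 2 * (γ * v1 r T κ t) * (∑ i, (μ i - r) * (s i * pd (V t) i s)) + θ := by
      have e1 : (∑ i, ∑ j, (σ * σ.transpose) i j
            * (s i * s j * (pd (V t) i s * pd (V t) j s)))
          = (fun i => s i * pd (V t) i s) ⬝ᵥ (σ * σ.transpose).mulVec
              (fun i => s i * pd (V t) i s) := by
        simp only [dotProduct, Matrix.mulVec, Finset.mul_sum]
        refine Finset.sum_congr rfl fun i _ => Finset.sum_congr rfl fun j _ => ?_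
        ring
      have e2 : (∑ i, (μ i - r) * (s i * pd (V t) i s))
          = (fun i => s i * pd (V t) i s) ⬝ᵥ (fun j => μ j - r) := by
        simp only [dotProduct]
        exact Finset.sum_congr rfl fun i _ => mul_comm _ _
      have e3 : θ = (σ * σ.transpose)⁻¹.mulVec (fun j => μ j - r) ⬝ᵥ (fun j => μ j - r) := by
        rw [hθ]; simp only [dotProduct]
        exact Finset.sum_congr rfl fun i _ => mul_comm _ _
      have e4 := quad_symm σ (fun i => s i * pd (V t) i s)
        ((σ * σ.transpose)⁻¹.mulVec (fun j => μ j - r))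
      rw [hMinv] at e4
      rw [e1, e2, e3, hygv, Matrix.mulVec_add, Matrix.mulVec_smul, hMinv]
      simp only [dotProduct_add, add_dotProduct, smul_dotProduct, dotProduct_smul, smul_eq_mul]
      rw [e4]
      have hγ' := hγ.ne'
      have hp1' := hp1.ne'
      field_simp
      ring
    have s1 : ∑ i, μ i * (s i * (v t s z * (γ * v1 r T κ t * pd (V t) i s)))
        = v t s z * (γ * v1 r T κ t) * ((∑ i, (μ i - r) * (s i * pd (V t) i s))
          + ∑ i, r * (s i * pd (V t) i s)) := by
      rw [← Finset.sum_add_distrib, Finset.mul_sum]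
      refine Finset.sum_congr rfl fun i _ => ?_
      ring
    have s2 : ∑ i, ∑ j, (σ * σ.transpose) i j * (s i * s j * (v t s z * ((γ * v1 r T κ t) ^ 2
          * (pd (V t) i s * pd (V t) j s) + γ * v1 r T κ t * pd (pd (V t) j) i s)))
        = v t s z * ((γ * v1 r T κ t) ^ 2 * (∑ i, ∑ j, (σ * σ.transpose) i j
            * (s i * s j * (pd (V t) i s * pd (V t) j s)))
          + γ * v1 r T κ t * ∑ i, ∑ j, (σ * σ.transpose) i j
            * (s i * s j * pd (pd (V t) j) i s)) := by
      simp only [mul_add, Finset.mul_sum, ← Finset.sum_add_distrib]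
      refine Finset.sum_congr rfl fun i _ => Finset.sum_congr rfl fun j _ => ?_
      ring
    rw [s1, s2]
    linear_combination (1 / 2 * v t s z) * hquad + (v t s z * γ * v1 r T κ t) * hpde
  · intro t ht s hs z _
    refine ⟨hle t ht s hs z, fun y hy => ?_⟩
    rw [hFyg t ht s hs, hFq t ht s hs] at hy
    have h1 := hc t ht s z
    have h2 : (1 / 2 * ((γ * v1 r T κ t) ^ 2 * (-v t s z)))
          * ∑ i, (∑ j, σ j i * (y - yg t s) j) ^ 2 = 0 := by linarith
    have h3 : (1 / 2 * ((γ * v1 r T κ t) ^ 2 * (-v t s z))) ≠ 0 := by positivity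
    have h4 := (mul_eq_zero.mp h2).resolve_left h3
    exact sub_eq_zero.mp (quad_zero σ hσ _ h4)
end

section
/- Let σ > 0, ᾱ ≠ 0 and λ¹⁰ ≥ 0, λ⁰¹ ≥ 0 with λ¹⁰ + λ⁰¹ > 0. Set ρ₀ := ( (3/4) ᾱ² (λ¹⁰+λ⁰¹)/σ² )^{1/3} > 0 and ā := σ²ρ₀²/2, and define w̄ : ℝ → ℝ by w̄(ρ) := −σ²ρ⁴/(12ᾱ²) + σ²ρ₀²ρ²/(2ᾱ²) + (λ¹⁰−λ⁰¹)ρ/2 for |ρ| ≤ ρ₀, w̄(ρ) := −(3/16)(λ¹⁰+λ⁰¹)ρ₀ + λ¹⁰ρ for ρ ≥ ρ₀, and w̄(ρ) := −(3/16)(λ¹⁰+λ⁰¹)ρ₀ − λ⁰¹ρ for ρ ≤ −ρ₀. Then w̄ is twice continuously differentiable on ℝ, convex, satisfies w̄(0) = 0, and solves the one-dimensional normalized first corrector equation pointwise: for every ρ ∈ ℝ, max{ −σ²ρ²/2 − (ᾱ²/2) w̄''(ρ) + ā , −λ¹⁰ + w̄'(ρ) , −λ⁰¹ − w̄'(ρ)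 } = 0. -/
/-- The explicit solution `w̄` of the one-dimensional normalized first corrector
equation, with transaction costs `l10 = λ¹⁰`, `l01 = λ⁰¹` and no-transaction
boundary `ρ₀`. -/
noncomputable def wbar (σ α l10 l01 ρ0 : ℝ) : ℝ → ℝ := fun ρ =>
  if ρ ≤ -ρ0 then -(3 / 16) * (l10 + l01) * ρ0 - l01 * ρ
  else if ρ < ρ0 then
    -(σ ^ 2 * ρ ^ 4) / (12 * α ^ 2) + σ ^ 2 * ρ0 ^ 2 * ρ ^ 2 / (2 * α ^ 2)
      + (l10 - l01) * ρ / 2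
  else -(3 / 16) * (l10 + l01) * ρ0 + l10 * ρ

theorem glue_hasDerivAt {p q p' q' : ℝ → ℝ} {a : ℝ} (hp : ∀ x, HasDerivAt p (p' x) x)
    (hq : ∀ x, HasDerivAt q (q' x) x) (h0 : p a = q a) (h1 : p' a = q' a) (x : ℝ) :
    HasDerivAt (fun y => if y ≤ a then p y else q y) (if x ≤ a then p' x else q' x) x := by
  rcases lt_trichotomy x a with h | h | h
  · rw [if_pos h.le]
    refine (hp x).congr_of_eventuallyEq ?_
    filter_upwards [Iio_mem_nhds h] with y hy
    exact if_pos (le_of_lt hy)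
  · subst h
    rw [if_pos le_rfl]
    have hl : HasDerivWithinAt (fun y => if y ≤ x then p y else q y) (p' x) (Set.Iic x) x :=
      (hp x).hasDerivWithinAt.congr (fun y hy => if_pos hy) (if_pos le_rfl)
    have hr : HasDerivWithinAt (fun y => if y ≤ x then p y else q y) (p' x) (Set.Ici x) x := by
      rw [h1]
      refine (hq x).hasDerivWithinAt.congr (fun y hy => ?_) (by simp [h0])
      rcases eq_or_lt_of_le (show x ≤ y from hy) with e | e
      · subst e; simp [h0]
      · exact if_neg (not_le.2 e)
    have := hl.union hr
    rwa [Set.Iic_union_Ici, hasDerivWithinAt_univ] at this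
  · rw [if_neg (not_le.2 h)]
    refine (hq x).congr_of_eventuallyEq ?_
    filter_upwards [Ioi_mem_nhds h] with y hy
    exact if_neg (not_le.2 hy)

theorem stmt7 (σ α l10 l01 : ℝ) (hσ : 0 < σ) (hα : α ≠ 0)
    (h10 : 0 ≤ l10) (h01 : 0 ≤ l01) (hsum : 0 < l10 + l01)
    (ρ0 abar : ℝ)
    (hρ0 : ρ0 = (3 / 4 * α ^ 2 * (l10 + l01) / σ ^ 2) ^ ((1 : ℝ) / 3))
    (habar : abar = σ ^ 2 * ρ0 ^ 2 / 2) :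
    0 < ρ0 ∧
    ContDiff ℝ 2 (wbar σ α l10 l01 ρ0) ∧
    ConvexOn ℝ Set.univ (wbar σ α l10 l01 ρ0) ∧
    wbar σ α l10 l01 ρ0 0 = 0 ∧
    (∀ ρ : ℝ,
      max (max (-(σ ^ 2 * ρ ^ 2) / 2
            - α ^ 2 / 2 * deriv (deriv (wbar σ α l10 l01 ρ0)) ρ + abar)
          (-l10 + deriv (wbar σ α l10 l01 ρ0) ρ))
        (-l01 - deriv (wbar σ α l10 l01 ρ0) ρ) = 0) := by
  have hα2 : 0 < α ^ 2 := by positivity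
  have hbase : 0 < 3 / 4 * α ^ 2 * (l10 + l01) / σ ^ 2 := by positivity
  have hpos : 0 < ρ0 := by rw [hρ0]; exact Real.rpow_pos_of_pos hbase _
  have hcube : ρ0 ^ 3 = 3 / 4 * α ^ 2 * (l10 + l01) / σ ^ 2 := by
    rw [hρ0, ← Real.rpow_natCast, ← Real.rpow_mul hbase.le]
    norm_num
  clear hρ0
  obtain ⟨k, hk⟩ : ∃ k, k = σ ^ 2 / α ^ 2 := ⟨_, rfl⟩
  have hkpos : 0 < k := by rw [hk]; positivity
  have hkσ : α ^ 2 * k = σ ^ 2 := by rw [hk]; field_simp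
  have hk3 : k * ρ0 ^ 3 = 3 / 4 * (l10 + l01) := by
    rw [hcube, hk]; field_simp
  have hneg : -ρ0 ≤ ρ0 := by linarith
  have hw : wbar σ α l10 l01 ρ0 = fun ρ =>
      if ρ ≤ -ρ0 then -(3 / 16) * (l10 + l01) * ρ0 - l01 * ρ
      else if ρ ≤ ρ0 then -k / 12 * ρ ^ 4 + k * ρ0 ^ 2 / 2 * ρ ^ 2 + (l10 - l01) / 2 * ρ
      else -(3 / 16) * (l10 + l01) * ρ0 + l10 * ρ := by
    funext ρ
    have e : -(σ ^ 2 * ρ ^ 4) / (12 * α ^ 2) + σ ^ 2 * ρ0 ^ 2 * ρ ^ 2 / (2 * α ^ 2)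
      + (l10 - l01) * ρ / 2
      = -k / 12 * ρ ^ 4 + k * ρ0 ^ 2 / 2 * ρ ^ 2 + (l10 - l01) / 2 * ρ := by
      rw [hk]; field_simp
    unfold wbar
    simp only [e]
    split_ifs with h1 h2 h3 h4
    · rfl
    · rfl
    · linarith
    · obtain rfl : ρ = ρ0 := le_antisymm h4 (not_lt.1 h2)
      linear_combination (-5 / 12 * ρ) * hk3
    · rfl
  have hd1 : ∀ ρ, HasDerivAt (wbar σ α l10 l01 ρ0) (if ρ ≤ -ρ0 then -l01
      else if ρ ≤ ρ0 then -k / 3 * ρ ^ 3 + k * ρ0 ^ 2 * ρ + (l10 - l01) / 2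
      else l10) ρ := by
    rw [hw]
    refine glue_hasDerivAt (p' := fun _ => -l01) (q' := fun ρ =>
      if ρ ≤ ρ0 then -k / 3 * ρ ^ 3 + k * ρ0 ^ 2 * ρ + (l10 - l01) / 2 else l10)
      (fun x => ?_) (glue_hasDerivAt (p' := fun ρ =>
        -k / 3 * ρ ^ 3 + k * ρ0 ^ 2 * ρ + (l10 - l01) / 2) (q' := fun _ => l10)
        (fun x => ?_) (fun x => ?_) ?_ ?_) ?_ ?_
    · exact HasDerivAt.congr_deriv (((hasDerivAt_id x).const_mul l01).const_sub _) (by ring)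
    · exact HasDerivAt.congr_deriv ((((hasDerivAt_pow 4 x).const_mul (-k / 12)).add
        ((hasDerivAt_pow 2 x).const_mul (k * ρ0 ^ 2 / 2))).add
        ((hasDerivAt_id x).const_mul ((l10 - l01) / 2))) (by norm_num; ring)
    · exact HasDerivAt.congr_deriv (((hasDerivAt_id x).const_mul l10).const_add _) (by ring)
    · linear_combination (5 / 12 * ρ0) * hk3
    · linear_combination (2 / 3) * hk3
    · simp only [if_pos hneg]
      linear_combination (-5 / 12 * ρ0) * hk3
    · simp only [if_pos hneg]
      linear_combination (2 / 3) * hk3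
  have hD1 : deriv (wbar σ α l10 l01 ρ0) = fun ρ => if ρ ≤ -ρ0 then -l01
      else if ρ ≤ ρ0 then -k / 3 * ρ ^ 3 + k * ρ0 ^ 2 * ρ + (l10 - l01) / 2
      else l10 := funext fun ρ => (hd1 ρ).deriv
  have hd2 : ∀ ρ, HasDerivAt (deriv (wbar σ α l10 l01 ρ0)) (if ρ ≤ -ρ0 then 0
      else if ρ ≤ ρ0 then k * (ρ0 ^ 2 - ρ ^ 2) else 0) ρ := by
    rw [hD1]
    refine glue_hasDerivAt (p' := fun _ => 0) (q' := fun ρ =>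
      if ρ ≤ ρ0 then k * (ρ0 ^ 2 - ρ ^ 2) else 0)
      (fun x => hasDerivAt_const _ _) (glue_hasDerivAt (p' := fun ρ =>
        k * (ρ0 ^ 2 - ρ ^ 2)) (q' := fun _ => 0)
        (fun x => ?_) (fun x => hasDerivAt_const _ _) ?_ ?_) ?_ ?_
    · exact HasDerivAt.congr_deriv ((((hasDerivAt_pow 3 x).const_mul (-k / 3)).add
        ((hasDerivAt_id x).const_mul (k * ρ0 ^ 2))).add_const ((l10 - l01) / 2)) (by norm_num; ring)
    · linear_combination (2 / 3) * hk3
    · ring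
    · simp only [if_pos hneg]
      linear_combination (2 / 3) * hk3
    · simp only [if_pos hneg]
      ring
  have hD2 : deriv (deriv (wbar σ α l10 l01 ρ0)) = fun ρ => if ρ ≤ -ρ0 then 0
      else if ρ ≤ ρ0 then k * (ρ0 ^ 2 - ρ ^ 2) else 0 := funext fun ρ => (hd2 ρ).deriv
  have hC2 : Continuous (deriv (deriv (wbar σ α l10 l01 ρ0))) := by
    rw [hD2]
    refine Continuous.if_le continuous_const (Continuous.if_le (by fun_prop) continuous_const
      continuous_id continuous_const ?_) continuous_id continuous_const ?_
    · rintro x rfl; simp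
    · rintro x rfl; simp [hneg]
  have hdiff : Differentiable ℝ (wbar σ α l10 l01 ρ0) := fun x => (hd1 x).differentiableAt
  have hdiff2 : Differentiable ℝ (deriv (wbar σ α l10 l01 ρ0)) :=
    fun x => (hd2 x).differentiableAt
  refine ⟨hpos, ?_, ?_, ?_, ?_⟩
  · rw [show (2 : WithTop ℕ∞) = 1 + 1 by norm_num, contDiff_succ_iff_deriv]
    refine ⟨hdiff, by simp, ?_⟩
    rw [contDiff_one_iff_deriv]
    exact ⟨hdiff2, hC2⟩
  · refine convexOn_univ_of_deriv2_nonneg hdiff hdiff2 fun x => ?_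
    change 0 ≤ deriv (deriv (wbar σ α l10 l01 ρ0)) x
    rw [hD2]
    dsimp only
    split_ifs with h1 h2
    · exact le_rfl
    · exact mul_nonneg hkpos.le (by nlinarith)
    · exact le_rfl
  · simp [wbar, hpos, not_le.2 hpos]
  · intro ρ
    rw [hD2, hD1, habar]
    dsimp only
    split_ifs with h1 h2
    · have : σ ^ 2 * ρ0 ^ 2 ≤ σ ^ 2 * ρ ^ 2 :=
        mul_le_mul_of_nonneg_left (by nlinarith) (by positivity)
      rw [max_eq_right (max_le (by linarith) (by linarith))]
      ring
    · have e : -(σ ^ 2 * ρ ^ 2) / 2 - α ^ 2 / 2 * (k * (ρ0 ^ 2 - ρ ^ 2))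
          + σ ^ 2 * ρ0 ^ 2 / 2 = 0 := by
        linear_combination (-(ρ0 ^ 2 - ρ ^ 2) / 2) * hkσ
      have i1 : 0 ≤ k * ((ρ0 - ρ) ^ 2 * (2 * ρ0 + ρ)) :=
        mul_nonneg hkpos.le (mul_nonneg (sq_nonneg _) (by linarith))
      have i2 : 0 ≤ k * ((ρ0 + ρ) ^ 2 * (2 * ρ0 - ρ)) :=
        mul_nonneg hkpos.le (mul_nonneg (sq_nonneg _) (by linarith))
      rw [e, max_eq_left (a := (0 : ℝ)) (by nlinarith), max_eq_left (by nlinarith)]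
    · have : σ ^ 2 * ρ0 ^ 2 ≤ σ ^ 2 * ρ ^ 2 :=
        mul_le_mul_of_nonneg_left (by nlinarith) (by positivity)
      rw [max_eq_right (a := _ + _) (by linarith), max_eq_left (by linarith)]
      ring
end

section
/- Let d ≥ 1, ε > 0, c₀ ∈ (0,1], p ≥ 0 a real number, q ∈ ℝ^d, w ∈ ℝ^d with w^i > 0 for all i, and λ^{i,0} ≥ 0, λ^{0,i} ≥ 0 for i = 1,…,d, and set λ̄ := max_{1≤i≤d} max(λ^{i,0}, λ^{0,i}). Assume S := ε³ Σ_{i=1}^d λ^{i,0} w^i/(1+ε³λ^{i,0}) ≤ 1 − c₀, and that for every i = 1,…,d: (ε⁴λ^{i,0}/(1+ε³λ^{i,0})) p − (ε³λ^{i,0}/(1+ε³λ^{i,0})) (w·q) + q^i ≥ 0 and ε⁴λ^{0,i} p − ε³λ^{0,i} (w·q) − q^i ≥ 0. Then |q^i| ≤ (λ̄/c₀) ε⁴ p for every i = 1,…,d. -/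
open scoped BigOperators

theorem stmt9 (d : ℕ) (hd : 1 ≤ d) (ε c₀ p : ℝ) (hε : 0 < ε)
    (hc₀ : c₀ ∈ Set.Ioc (0 : ℝ) 1) (hp : 0 ≤ p)
    (q w : Fin d → ℝ) (hw : ∀ i, 0 < w i)
    (lam10 lam01 : Fin d → ℝ) (h10 : ∀ i, 0 ≤ lam10 i) (h01 : ∀ i, 0 ≤ lam01 i)
    (lambar : ℝ)
    (hlambar : lambar = Finset.univ.sup' (Finset.univ_nonempty_iff.mpr ⟨⟨0, hd⟩⟩)
      fun i => max (lam10 i) (lam01 i))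
    (hS : ε ^ 3 * ∑ i, lam10 i * w i / (1 + ε ^ 3 * lam10 i) ≤ 1 - c₀)
    (hineq1 : ∀ i, 0 ≤ ε ^ 4 * lam10 i / (1 + ε ^ 3 * lam10 i) * p
      - ε ^ 3 * lam10 i / (1 + ε ^ 3 * lam10 i) * (∑ j, w j * q j) + q i)
    (hineq2 : ∀ i, 0 ≤ ε ^ 4 * lam01 i * p
      - ε ^ 3 * lam01 i * (∑ j, w j * q j) - q i) :
    ∀ i, |q i| ≤ lambar / c₀ * (ε ^ 4 * p) := by
  obtain ⟨hc, hc1⟩ := hc₀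
  set Q := ∑ j, w j * q j with hQ
  have he3 : 0 < ε ^ 3 := by positivity
  have hden : ∀ i, 0 < 1 + ε ^ 3 * lam10 i := fun i => by
    have := mul_nonneg he3.le (h10 i)
    linarith
  have h1 : ∀ i, -(ε ^ 3 * (lam10 i / (1 + ε ^ 3 * lam10 i)) * (ε * p - Q)) ≤ q i := by
    intro i
    have h := hineq1 i
    have e : ε ^ 4 * lam10 i / (1 + ε ^ 3 * lam10 i) * p
      - ε ^ 3 * lam10 i / (1 + ε ^ 3 * lam10 i) * Q
      = ε ^ 3 * (lam10 i / (1 + ε ^ 3 * lam10 i)) * (ε * p - Q) := by ring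
    linarith
  have hsum : -(ε ^ 3 * ∑ i, lam10 i * w i / (1 + ε ^ 3 * lam10 i)) * (ε * p - Q) ≤ Q := by
    calc -(ε ^ 3 * ∑ i, lam10 i * w i / (1 + ε ^ 3 * lam10 i)) * (ε * p - Q)
        = ∑ i, w i * -(ε ^ 3 * (lam10 i / (1 + ε ^ 3 * lam10 i)) * (ε * p - Q)) := by
          rw [neg_mul, Finset.mul_sum, Finset.sum_mul, ← Finset.sum_neg_distrib]
          exact Finset.sum_congr rfl fun i _ => by ring
      _ ≤ Q := Finset.sum_le_sum fun i _ => mul_le_mul_of_nonneg_left (h1 i) (hw i).le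
  have hep : 0 ≤ ε * p := by positivity
  have hT : ε * p - Q ≤ ε * p / c₀ := by
    rw [le_div_iff₀ hc]
    rcases le_total 0 (ε * p - Q) with h | h
    · have := mul_le_mul_of_nonneg_right hS h
      linarith
    · have := mul_nonpos_of_nonpos_of_nonneg h hc.le
      linarith
  have hB : 0 ≤ ε * p / c₀ := by positivity
  have key : ∀ a, 0 ≤ a → a ≤ lambar →
      ε ^ 3 * a * (ε * p - Q) ≤ lambar / c₀ * (ε ^ 4 * p) := by
    intro a ha hal
    calc ε ^ 3 * a * (ε * p - Q) ≤ ε ^ 3 * a * (ε * p / c₀) := by gcongr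
      _ ≤ ε ^ 3 * lambar * (ε * p / c₀) := by gcongr
      _ = lambar / c₀ * (ε ^ 4 * p) := by ring
  intro i
  have hmax : max (lam10 i) (lam01 i) ≤ lambar := by
    rw [hlambar]
    exact Finset.le_sup' (fun i => max (lam10 i) (lam01 i)) (Finset.mem_univ i)
  have hle : lam10 i / (1 + ε ^ 3 * lam10 i) ≤ lam10 i :=
    div_le_self (h10 i) (by linarith [mul_nonneg he3.le (h10 i)])
  rw [abs_le]
  constructor
  · have := key _ (div_nonneg (h10 i) (hden i).le)
      (hle.trans ((le_max_left _ _).trans hmax))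
    linarith [h1 i]
  · have := key _ (h01 i) ((le_max_right _ _).trans hmax)
    have h := hineq2 i
    have e : ε ^ 4 * lam01 i * p - ε ^ 3 * lam01 i * Q
      = ε ^ 3 * lam01 i * (ε * p - Q) := by ring
    linarith
end

section
/- Let n ≥ 1, let K ⊆ ℝ^n be a nonempty compact set, ε₀ > 0, and for each ε ∈ (0,ε₀] let f^ε : K × ℝ → ℝ be such that q ↦ f^ε(b,q) is nondecreasing for each b ∈ K, and let g^ε : K → ℝ. Let p, h, c : K → ℝ with inf_{b∈K} c(b) > 0, and assume that for every δ ∈ (−1,1), sup_{b∈K} | (f^ε(b, p(b) + ε²h(b) + ε²δ) − g^ε(b))/ε² − δ c(b) | → 0 as ε → 0. Assume further that for every ε ∈ (0,ε₀] and b ∈ K the set { q ∈ ℝ : f^ε(b,q) ≥ g^ε(b) } is nonempty and bounded below, and define P^ε(b) := inf{ q ∈ ℝ : f^ε(b,q) ≥ g^ε(b) }. Then sup_{b∈K} |P^ε(b) − p(b) − ε²h(b)|/ε² → 0 as ε → 0. -/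
theorem stmt11 (n : ℕ) (hn : 1 ≤ n) (K : Set (Fin n → ℝ))
    (hK : IsCompact K) (hKne : K.Nonempty) (ε₀ : ℝ) (hε₀ : 0 < ε₀)
    (f : ℝ → (Fin n → ℝ) → ℝ → ℝ) (g : ℝ → (Fin n → ℝ) → ℝ)
    (p h c : (Fin n → ℝ) → ℝ)
    (hmono : ∀ ε ∈ Set.Ioc 0 ε₀, ∀ b ∈ K, Monotone (f ε b))
    (hc : ∃ c₀ > 0, ∀ b ∈ K, c₀ ≤ c b)
    (hconv : ∀ δ ∈ Set.Ioo (-1 : ℝ) 1, ∀ η > 0, ∃ ε₁ > 0,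
      ∀ ε ∈ Set.Ioc 0 ε₀, ε ≤ ε₁ → ∀ b ∈ K,
        |(f ε b (p b + ε ^ 2 * h b + ε ^ 2 * δ) - g ε b) / ε ^ 2 - δ * c b| ≤ η)
    (hset : ∀ ε ∈ Set.Ioc 0 ε₀, ∀ b ∈ K,
      ({q : ℝ | f ε b q ≥ g ε b}).Nonempty ∧ BddBelow {q : ℝ | f ε b q ≥ g ε b})
    (P : ℝ → (Fin n → ℝ) → ℝ)
    (hP : ∀ ε ∈ Set.Ioc 0 ε₀, ∀ b ∈ K, P ε b = sInf {q : ℝ | f ε b q ≥ g ε b}) :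
    ∀ η > 0, ∃ ε₁ > 0, ∀ ε ∈ Set.Ioc 0 ε₀, ε ≤ ε₁ → ∀ b ∈ K,
      |P ε b - p b - ε ^ 2 * h b| / ε ^ 2 ≤ η := by
  intro η hη
  obtain ⟨c₀, hc₀, hcb⟩ := hc
  obtain ⟨δ, hδ0, hδη, hδ1⟩ : ∃ δ : ℝ, 0 < δ ∧ δ ≤ η ∧ δ < 1 :=
    ⟨min η (1/2), by positivity, min_le_left _ _, lt_of_le_of_lt (min_le_right _ _) (by norm_num)⟩
  have hτ : 0 < δ * c₀ / 2 := by positivity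
  obtain ⟨e1, he1, h1⟩ := hconv δ ⟨by linarith, hδ1⟩ _ hτ
  obtain ⟨e2, he2, h2⟩ := hconv (-δ) ⟨by linarith, by linarith⟩ _ hτ
  refine ⟨min e1 e2, lt_min he1 he2, fun ε hε hle b hb => ?_⟩
  have hε2 : 0 < ε ^ 2 := pow_pos hε.1 2
  have a1 := (abs_le.mp (h1 ε hε (hle.trans (min_le_left _ _)) b hb)).1
  have a2 := (abs_le.mp (h2 ε hε (hle.trans (min_le_right _ _)) b hb)).2
  have hcδ : δ * c₀ ≤ δ * c b := mul_le_mul_of_nonneg_left (hcb b hb) hδ0.le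
  have b1 : 0 < (f ε b (p b + ε ^ 2 * h b + ε ^ 2 * δ) - g ε b) / ε ^ 2 := by linarith
  have b2 : (f ε b (p b + ε ^ 2 * h b + ε ^ 2 * (-δ)) - g ε b) / ε ^ 2 < 0 := by linarith
  rw [lt_div_iff₀ hε2, zero_mul] at b1
  rw [div_lt_iff₀ hε2, zero_mul] at b2
  obtain ⟨hne, hbd⟩ := hset ε hε b hb
  have u : P ε b ≤ p b + ε ^ 2 * h b + ε ^ 2 * δ := by
    rw [hP ε hε b hb]
    exact csInf_le hbd (by simp only [Set.mem_setOf_eq]; linarith)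
  have l : p b + ε ^ 2 * h b + ε ^ 2 * (-δ) ≤ P ε b := by
    rw [hP ε hε b hb]
    refine le_csInf hne fun q hq => ?_
    by_contra hlt
    have := hmono ε hε b hb (not_le.mp hlt).le
    simp only [Set.mem_setOf_eq] at hq
    linarith
  rw [div_le_iff₀ hε2]
  have : δ * ε ^ 2 ≤ η * ε ^ 2 := mul_le_mul_of_nonneg_right hδη hε2.le
  rw [abs_le]
  constructor <;> linarith
end

section
/- Fix d ≥ 1 and transaction-cost coefficients λ^{i,j} ∈ [0,+∞] (0 ≤ i,j ≤ d) with λ^{i,i} = 0 and λ^{i,0}, λ^{0,i} < +∞ for all i = 1,…,d. Let U₂ : ℝ → ℝ be continuously differentiable and g : (0,∞)^d → ℝ continuous. Then for every compact set K ⊆ (0,∞)^d × ℝ × ℝ^d, sup_{(s,x,y)∈K} | U₂( x + Σ_{i=1}^d y^i − g(s) ) − U₂( ℓ^ε(x,y) − g(s) ) | / ε² → 0 as ε ↓ 0. -/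
open scoped ENNReal BigOperators

theorem liq_bound (d : ℕ) (ε : ℝ) (hε : 0 < ε) (lam : Fin (d + 1) → Fin (d + 1) → ℝ≥0∞)
    (hrow : ∀ i : Fin d, lam i.succ 0 ≠ ∞)
    (hcol : ∀ i : Fin d, lam 0 i.succ ≠ ∞) (x : ℝ) (y : Fin d → ℝ) :
    |(x + ∑ i, y i) - liq d ε lam x y| ≤
      ε ^ 3 * ∑ i, |y i| * ((lam i.succ 0).toReal + (lam 0 i.succ).toReal) := by
  set S := ∑ i, |y i| * ((lam i.succ 0).toReal + (lam 0 i.succ).toReal) with hS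
  have hε3 : 0 < ε ^ 3 := by positivity
  have hone : (fun _ => (1 : ℝ)) ∈ dualCone d ε lam := by
    refine ⟨fun _ => zero_le_one, rfl, fun i j _ => ?_⟩
    have : 0 ≤ ε ^ 3 * (lam i j).toReal := by positivity
    linarith
  have hlow : ∀ b ∈ ((fun r : Fin (d + 1) → ℝ => x * r 0 + ∑ i : Fin d, y i * r i.succ) ''
      dualCone d ε lam), (x + ∑ i, y i) - ε ^ 3 * S ≤ b := by
    rintro _ ⟨r, ⟨h0, h1, h2⟩, rfl⟩
    have key : ∑ i, (y i - y i * r i.succ) ≤ ε ^ 3 * S := by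
      rw [hS, Finset.mul_sum]
      refine Finset.sum_le_sum fun i _ => ?_
      have ha : 0 ≤ ε ^ 3 * (lam i.succ 0).toReal := by positivity
      have hb : 0 ≤ ε ^ 3 * (lam 0 i.succ).toReal := by positivity
      have h3 := h2 _ _ (hrow i)
      have h4 := h2 _ _ (hcol i)
      rw [h1] at h3 h4
      have h5 : |1 - r i.succ| ≤
          ε ^ 3 * ((lam i.succ 0).toReal + (lam 0 i.succ).toReal) := by
        rw [abs_le]
        constructor
        · linarith
        · rcases le_total (r i.succ) 1 with h | h
          · nlinarith
          · linarith
      calc y i - y i * r i.succ = y i * (1 - r i.succ) := by ring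
        _ ≤ |y i * (1 - r i.succ)| := le_abs_self _
        _ = |y i| * |1 - r i.succ| := abs_mul _ _
        _ ≤ |y i| * (ε ^ 3 * ((lam i.succ 0).toReal + (lam 0 i.succ).toReal)) := by gcongr
        _ = _ := by ring
    rw [Finset.sum_sub_distrib] at key
    simp only [h1]
    linarith
  have hA : (x + ∑ i, y i) - ε ^ 3 * S ≤ liq d ε lam x y :=
    le_csInf ⟨_, _, hone, rfl⟩ hlow
  have hB : liq d ε lam x y ≤ x + ∑ i, y i := by
    refine csInf_le ⟨_, hlow⟩ ⟨_, hone, ?_⟩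
    simp
  rw [abs_le]
  have hSn : 0 ≤ ε ^ 3 * S := by linarith
  constructor <;> linarith

theorem stmt12 (d : ℕ) (hd : 1 ≤ d)
    (lam : Fin (d + 1) → Fin (d + 1) → ℝ≥0∞)
    (hdiag : ∀ i, lam i i = 0)
    (hrow : ∀ i : Fin d, lam i.succ 0 ≠ ∞)
    (hcol : ∀ i : Fin d, lam 0 i.succ ≠ ∞)
    (U₂ : ℝ → ℝ) (hU₂ : ContDiff ℝ 1 U₂)
    (g : (Fin d → ℝ) → ℝ) (hg : ContinuousOn g {s | ∀ i, 0 < s i})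
    (K : Set ((Fin d → ℝ) × ℝ × (Fin d → ℝ))) (hK : IsCompact K)
    (hKsub : ∀ q ∈ K, ∀ i, 0 < q.1 i) :
    ∀ η > 0, ∃ ε₀ > 0, ∀ ε : ℝ, 0 < ε → ε ≤ ε₀ → ∀ q ∈ K,
      |U₂ (q.2.1 + ∑ i, q.2.2 i - g q.1)
        - U₂ (liq d ε lam q.2.1 q.2.2 - g q.1)| / ε ^ 2 ≤ η := by
  intro η hη
  have hc1 : ContinuousOn (fun q : (Fin d → ℝ) × ℝ × (Fin d → ℝ) =>
      q.2.1 + ∑ i, q.2.2 i - g q.1) K := by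
    have h1 : ContinuousOn (fun q : (Fin d → ℝ) × ℝ × (Fin d → ℝ) => g q.1) K :=
      hg.comp continuous_fst.continuousOn (fun q hq => hKsub q hq)
    refine ContinuousOn.sub (Continuous.continuousOn ?_) h1
    fun_prop
  have hc2 : ContinuousOn (fun q : (Fin d → ℝ) × ℝ × (Fin d → ℝ) =>
      ∑ i, |q.2.2 i| * ((lam i.succ 0).toReal + (lam 0 i.succ).toReal)) K := by
    refine Continuous.continuousOn ?_
    fun_prop
  obtain ⟨M, hM⟩ := hK.exists_bound_of_continuousOn hc1
  obtain ⟨C₀, hC₀⟩ := hK.exists_bound_of_continuousOn hc2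
  obtain ⟨C, hC0, hC⟩ : ∃ C : ℝ, 0 ≤ C ∧ C₀ ≤ C := ⟨max 0 C₀, le_max_left _ _, le_max_right _ _⟩
  obtain ⟨D₀, hD₀⟩ := (isCompact_Icc (a := -(M + C)) (b := M + C)).exists_bound_of_continuousOn
    (hU₂.continuous_deriv le_rfl).continuousOn
  obtain ⟨D, hD0, hD⟩ : ∃ D : ℝ, 0 ≤ D ∧ D₀ ≤ D := ⟨max 0 D₀, le_max_left _ _, le_max_right _ _⟩
  have hDC : 0 ≤ D * C := by positivity
  refine ⟨min 1 (η / (D * C + 1)), by positivity, fun ε hε hle q hq => ?_⟩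
  have hε1 : ε ≤ 1 := hle.trans (min_le_left _ _)
  have hε2 : ε * (D * C + 1) ≤ η := (le_div_iff₀ (by positivity)).1 (hle.trans (min_le_right _ _))
  have hb := liq_bound d ε hε lam hrow hcol q.2.1 q.2.2
  have h1 := hM q hq
  have h2 := (le_abs_self _).trans ((hC₀ q hq).trans hC)
  have hb' : |(q.2.1 + ∑ i, q.2.2 i) - liq d ε lam q.2.1 q.2.2| ≤ ε ^ 3 * C :=
    hb.trans (by gcongr)
  have hε3 : ε ^ 3 * C ≤ C := mul_le_of_le_one_left hC0 (pow_le_one₀ hε.le hε1)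
  rw [Real.norm_eq_abs, abs_le] at h1
  have h3 := abs_le.1 hb'
  have hlip := (convex_Icc (-(M + C)) (M + C)).norm_image_sub_le_of_norm_deriv_le (f := U₂) (C := D)
    (fun z _ => (hU₂.differentiable one_ne_zero) z)
    (fun z hz => (hD₀ z hz).trans hD)
    (x := liq d ε lam q.2.1 q.2.2 - g q.1) (y := q.2.1 + ∑ i, q.2.2 i - g q.1)
    ⟨by linarith, by linarith⟩ ⟨by linarith, by linarith⟩
  rw [Real.norm_eq_abs, Real.norm_eq_abs, sub_sub_sub_cancel_right] at hlip
  rw [div_le_iff₀ (by positivity)]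
  calc _ ≤ D * (ε ^ 3 * C) := hlip.trans (by gcongr)
    _ = (ε * (D * C)) * ε ^ 2 := by ring
    _ ≤ η * ε ^ 2 := by
      gcongr
      linarith
end
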